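/- Equality of the conjugate function on the two sides of a half-strip, and its nonnegativity: Let a > 0 and let u be a solution of the minimal surface equation on the open half-strip S = (0,a) × (0,∞) such that for every y₀ > 0, u(x,y) tends to −∞ as (x,y) ∈ S tends to (0,y₀), and u(x,y) tends to +∞ as (x,y) ∈ S tends to (a,y₀). Let Ψ be a conjugate function of u, extended continuously to the closed half-strip [0,a] × [0,∞). Then Ψ(0,y) = Ψ(a,y) for every y ≥ 0; moreover, if Ψ(0,0) = 0, then Ψ ≥ 0 everywhere on [0,a] × [0,∞). -/

import Mathlib

open Real Filter Set

/-- First partial derivative (in the `x` direction) of a function on `ℝ × ℝ`. -/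
noncomputable def pd1 (u : ℝ × ℝ → ℝ) (z : ℝ × ℝ) : ℝ := fderiv ℝ u z (1, 0)

/-- Second partial derivative (in the `y` direction) of a function on `ℝ × ℝ`. -/
noncomputable def pd2 (u : ℝ × ℝ → ℝ) (z : ℝ × ℝ) : ℝ := fderiv ℝ u z (0, 1)

/-- `W = √(1 + p² + q²)` associated to a function `u` on `ℝ × ℝ`. -/
noncomputable def Wf (u : ℝ × ℝ → ℝ) (z : ℝ × ℝ) : ℝ :=
  Real.sqrt (1 + pd1 u z ^ 2 + pd2 u z ^ 2)

/-- `u` is a solution of the minimal surface equation on the open set `U`. -/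
def IsMSESolution (U : Set (ℝ × ℝ)) (u : ℝ × ℝ → ℝ) : Prop :=
  ContDiffOn ℝ 2 u U ∧ ∀ z ∈ U,
    (1 + pd2 u z ^ 2) * pd1 (pd1 u) z
      - 2 * pd1 u z * pd2 u z * pd2 (pd1 u) z
      + (1 + pd1 u z ^ 2) * pd2 (pd2 u) z = 0

/-- `Ψ` is a conjugate function of the `C²` function `u` on `U`. -/
structure IsConjugateOn (U : Set (ℝ × ℝ)) (u Ψ : ℝ × ℝ → ℝ) : Prop where
  contDiffOn : ContDiffOn ℝ 2 u U
  differentiableAt : ∀ z ∈ U, DifferentiableAt ℝ Ψ z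
  pd1_eq : ∀ z ∈ U, pd1 Ψ z = - pd2 u z / Wf u z
  pd2_eq : ∀ z ∈ U, pd2 Ψ z = pd1 u z / Wf u z

lemma Wf_pos (u : ℝ × ℝ → ℝ) (z : ℝ × ℝ) : 0 < Wf u z := by
  unfold Wf; positivity

lemma Wf_sq (u : ℝ × ℝ → ℝ) (z : ℝ × ℝ) : Wf u z ^ 2 = 1 + pd1 u z ^ 2 + pd2 u z ^ 2 :=
  Real.sq_sqrt (by positivity)

lemma contDiffOn_pd1 {U : Set (ℝ × ℝ)} {u : ℝ × ℝ → ℝ} (hU : IsOpen U)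
    (hu : ContDiffOn ℝ 2 u U) : ContDiffOn ℝ 1 (pd1 u) U :=
  (hu.fderiv_of_isOpen hU (by norm_num)).clm_apply contDiffOn_const

lemma contDiffOn_pd2 {U : Set (ℝ × ℝ)} {u : ℝ × ℝ → ℝ} (hU : IsOpen U)
    (hu : ContDiffOn ℝ 2 u U) : ContDiffOn ℝ 1 (pd2 u) U :=
  (hu.fderiv_of_isOpen hU (by norm_num)).clm_apply contDiffOn_const

lemma contDiffOn_Wf {U : Set (ℝ × ℝ)} {u : ℝ × ℝ → ℝ} (hU : IsOpen U)
    (hu : ContDiffOn ℝ 2 u U) : ContDiffOn ℝ 1 (Wf u) U :=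
  ((contDiffOn_const.add ((contDiffOn_pd1 hU hu).pow 2)).add
    ((contDiffOn_pd2 hU hu).pow 2)).sqrt fun z _ => by positivity

lemma fderiv_eq_pd (u : ℝ × ℝ → ℝ) (z v : ℝ × ℝ) :
    fderiv ℝ u z v = v.1 * pd1 u z + v.2 * pd2 u z := by
  have hv : v = v.1 • ((1 : ℝ), (0 : ℝ)) + v.2 • ((0 : ℝ), (1 : ℝ)) := by ext <;> simp
  conv_lhs => rw [hv, map_add, map_smul, map_smul]
  rfl

/-- Monotonicity of `p ↦ p / √(1 + |p|²)` against the constant slope `(K, 0)`. -/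
lemma slope_monotone {p q K W V : ℝ} (hW : 0 < W) (hV : 0 < V) (hW2 : W ^ 2 = 1 + p ^ 2 + q ^ 2)
    (hV2 : V ^ 2 = 1 + K ^ 2) : 0 ≤ (p / W - K / V) * (p - K) + q / W * q := by
  have hcs : p * K + 1 ≤ W * V := by
    refine (abs_le_of_sq_le_sq' ?_ (by positivity)).2
    rw [mul_pow, hW2, hV2]
    nlinarith [sq_nonneg (p - K), sq_nonneg q, sq_nonneg (q * K)]
  have hnum : (p / W - K / V) * (p - K) + q / W * q = (V + W) * (W * V - (p * K + 1)) / (W * V) := by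
    field_simp
    linear_combination (-V) * hW2 - W * hV2
  rw [hnum]
  exact div_nonneg (mul_nonneg (by positivity) (by linarith)) (by positivity)

namespace IsConjugateOn

open scoped Topology

variable {a : ℝ} {U : Set (ℝ × ℝ)} {u Ψ : ℝ × ℝ → ℝ}

lemma contDiffOn_pd1 (h : IsConjugateOn U u Ψ) (hU : IsOpen U) : ContDiffOn ℝ 1 (pd1 Ψ) U :=
  ((_root_.contDiffOn_pd2 hU h.contDiffOn).neg.div (contDiffOn_Wf hU h.contDiffOn)
    fun z _ => (Wf_pos u z).ne').congr h.pd1_eq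

lemma contDiffOn_pd2 (h : IsConjugateOn U u Ψ) (hU : IsOpen U) : ContDiffOn ℝ 1 (pd2 Ψ) U :=
  ((_root_.contDiffOn_pd1 hU h.contDiffOn).div (contDiffOn_Wf hU h.contDiffOn)
    fun z _ => (Wf_pos u z).ne').congr h.pd2_eq

lemma pd1_sq_add_pd2_sq_le (h : IsConjugateOn U u Ψ) {z : ℝ × ℝ} (hz : z ∈ U) :
    pd1 Ψ z ^ 2 + pd2 Ψ z ^ 2 ≤ 1 := by
  have hW := Wf_pos u z
  rw [h.pd1_eq z hz, h.pd2_eq z hz, div_pow, div_pow, ← add_div, div_le_one (by positivity),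
    Wf_sq]
  linarith

lemma pd_comm (h : IsConjugateOn U u Ψ) (hU : IsOpen U) {z : ℝ × ℝ} (hz : z ∈ U) :
    pd1 (pd2 Ψ) z = pd2 (pd1 Ψ) z := by
  have hUz := hU.mem_nhds hz
  have h1 := ((h.contDiffOn_pd1 hU).contDiffAt hUz).differentiableAt one_ne_zero
  have h2 := ((h.contDiffOn_pd2 hU).contDiffAt hUz).differentiableAt one_ne_zero
  have hΨ : fderiv ℝ Ψ = fun w => pd1 Ψ w • ContinuousLinearMap.fst ℝ ℝ ℝ
      + pd2 Ψ w • ContinuousLinearMap.snd ℝ ℝ ℝ := by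
    funext w
    refine ContinuousLinearMap.ext fun v => ?_
    rw [fderiv_eq_pd]
    simp [mul_comm]
  have hD := (h1.hasFDerivAt.smul_const (ContinuousLinearMap.fst ℝ ℝ ℝ)).add
    (h2.hasFDerivAt.smul_const (ContinuousLinearMap.snd ℝ ℝ ℝ))
  have hsym := second_derivative_symmetric_of_eventually (f := Ψ) (f' := fderiv ℝ Ψ)
    (Filter.eventually_of_mem hUz fun w hw => (h.differentiableAt w hw).hasFDerivAt)
    (by rw [hΨ]; exact hD) (1, 0) (0, 1)
  simpa [pd1, pd2] using hsym

/-- Flux of `u` through the left side of a rectangle, compared with that of the plane `K * x`. -/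
lemma flux_comparison (h : IsConjugateOn U u Ψ) (hU : IsOpen U) {K b x₀ x₁ y₁ y₂ : ℝ}
    (hx : x₀ ≤ x₁) (hy : y₁ ≤ y₂) (hR : Icc x₀ x₁ ×ˢ Icc y₁ y₂ ⊆ U)
    (hl : ∀ y ∈ Icc y₁ y₂, u (x₀, y) - K * x₀ ≤ b - 1)
    (hr : ∀ y ∈ Icc y₁ y₂, b ≤ u (x₁, y) - K * x₁) :
    K / √(1 + K ^ 2) * (y₂ - y₁) - 2 * (x₁ - x₀) ≤ Ψ (x₀, y₂) - Ψ (x₀, y₁) := by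
  set k := K / √(1 + K ^ 2) with hk
  set w : ℝ × ℝ → ℝ := fun z => b - (u z - K * z.1) with hw
  set c : ℝ × ℝ → ℝ := fun z => smoothTransition (w z) with hc
  set f : ℝ × ℝ → ℝ := fun z => (pd2 Ψ z - k) * c z with hf
  set g : ℝ × ℝ → ℝ := fun z => - pd1 Ψ z * c z with hg
  have hwC : ContDiffOn ℝ 1 w U := contDiffOn_const.sub
    ((h.contDiffOn.of_le (by norm_num)).sub (contDiffOn_const.mul contDiffOn_fst))
  have hcC : ContDiffOn ℝ 1 c U := smoothTransition.contDiff.comp_contDiffOn hwC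
  have hfC : ContDiffOn ℝ 1 f U := ((h.contDiffOn_pd2 hU).sub contDiffOn_const).mul hcC
  have hgC : ContDiffOn ℝ 1 g U := (h.contDiffOn_pd1 hU).neg.mul hcC
  have hdiff : ∀ {F : ℝ × ℝ → ℝ}, ContDiffOn ℝ 1 F U → ∀ z ∈ U, DifferentiableAt ℝ F z :=
    fun hF z hz => (hF.contDiffAt (hU.mem_nhds hz)).differentiableAt one_ne_zero
  have hdiv : ∀ z ∈ U, fderiv ℝ f z (1, 0) + fderiv ℝ g z (0, 1) ≤ 0 := by
    intro z hz
    have hwd : HasFDerivAt w (-(fderiv ℝ u z - K • ContinuousLinearMap.fst ℝ ℝ ℝ)) z :=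
      ((hdiff (h.contDiffOn.of_le (by norm_num)) z hz).hasFDerivAt.sub
        (hasFDerivAt_fst.const_mul K)).const_sub b
    have hcd : HasFDerivAt c (deriv smoothTransition (w z) •
        (-(fderiv ℝ u z - K • ContinuousLinearMap.fst ℝ ℝ ℝ))) z :=
      ((smoothTransition.contDiff (n := 1)).differentiable
        (by norm_num) (w z)).hasDerivAt.comp_hasFDerivAt z hwd
    have hfd : HasFDerivAt f _ z :=
      ((hdiff (h.contDiffOn_pd2 hU) z hz).hasFDerivAt.sub_const k).mul hcd
    have hgd : HasFDerivAt g _ z := (hdiff (h.contDiffOn_pd1 hU) z hz).hasFDerivAt.neg.mul hcd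
    rw [hfd.fderiv, hgd.fderiv]
    have hpos : 0 ≤ deriv smoothTransition (w z) := smoothTransition.monotone.deriv_nonneg
    have hmono := slope_monotone (K := K) (Wf_pos u z) (V := √(1 + K ^ 2)) (by positivity)
      (Wf_sq u z) (Real.sq_sqrt (by positivity))
    have hval : (pd2 Ψ z - k) * (deriv smoothTransition (w z) * -(pd1 u z - K))
        + c z * pd1 (pd2 Ψ) z
        + (-pd1 Ψ z * (deriv smoothTransition (w z) * -pd2 u z) + c z * -pd2 (pd1 Ψ) z) ≤ 0 := by
      rw [h.pd_comm hU hz, h.pd1_eq z hz, h.pd2_eq z hz]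
      have := mul_nonneg hpos hmono
      rw [neg_div, neg_neg]
      linarith
    simpa [pd1, pd2] using hval
  have hsub : uIcc x₀ x₁ ×ˢ uIcc y₁ y₂ ⊆ U := by rwa [uIcc_of_le hx, uIcc_of_le hy]
  have hsub' : Ioo (min x₀ x₁) (max x₀ x₁) ×ˢ Ioo (min y₁ y₂) (max y₁ y₂) ⊆ U := by
    rw [min_eq_left hx, max_eq_right hx, min_eq_left hy, max_eq_right hy]
    exact (Set.prod_mono Ioo_subset_Icc_self Ioo_subset_Icc_self).trans hR
  have hcont : ContinuousOn (fun z => fderiv ℝ f z (1, 0) + fderiv ℝ g z (0, 1))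
      (uIcc x₀ x₁ ×ˢ uIcc y₁ y₂) :=
    (((hfC.continuousOn_fderiv_of_isOpen hU le_rfl).clm_apply continuousOn_const).add
      ((hgC.continuousOn_fderiv_of_isOpen hU le_rfl).clm_apply continuousOn_const)).mono hsub
  have hgreen := MeasureTheory.integral2_divergence_prod_of_hasFDerivAt f g (fderiv ℝ f)
    (fderiv ℝ g) x₀ y₁ x₁ y₂ (hfC.continuousOn.mono hsub) (hgC.continuousOn.mono hsub)
    (fun z hz => (hdiff hfC z (hsub' hz)).hasFDerivAt)
    (fun z hz => (hdiff hgC z (hsub' hz)).hasFDerivAt)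
    (hcont.integrableOn_compact (isCompact_uIcc.prod isCompact_uIcc))
  have hint : (∫ x in x₀..x₁, ∫ y in y₁..y₂,
      fderiv ℝ f (x, y) (1, 0) + fderiv ℝ g (x, y) (0, 1)) ≤ 0 := by
    rw [← neg_nonneg, ← intervalIntegral.integral_neg]
    refine intervalIntegral.integral_nonneg hx fun x hxx => ?_
    rw [← intervalIntegral.integral_neg]
    exact intervalIntegral.integral_nonneg hy fun y hyy => neg_nonneg.2 (hdiv _ (hR ⟨hxx, hyy⟩))
  have hg_bound : ∀ y ∈ Icc y₁ y₂, |∫ x in x₀..x₁, g (x, y)| ≤ x₁ - x₀ := by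
    intro y hyy
    have := intervalIntegral.norm_integral_le_of_norm_le_const (a := x₀) (b := x₁) (C := 1)
      (f := fun x => g (x, y)) fun x hxx => ?_
    · simpa [abs_of_nonneg (sub_nonneg.2 hx)] using this
    · rw [uIoc_of_le hx] at hxx
      have hp := h.pd1_sq_add_pd2_sq_le (z := (x, y)) (hR ⟨Ioc_subset_Icc_self hxx, hyy⟩)
      have hp1 : |pd1 Ψ (x, y)| ≤ 1 := by
        rw [← sq_le_one_iff_abs_le_one]
        linarith [sq_nonneg (pd2 Ψ (x, y))]
      rw [Real.norm_eq_abs, hg, abs_mul, abs_neg, abs_of_nonneg (smoothTransition.nonneg _)]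
      exact mul_le_one₀ hp1 (smoothTransition.nonneg _) (smoothTransition.le_one _)
  have hf_right : ∫ y in y₁..y₂, f (x₁, y) = 0 := by
    refine (intervalIntegral.integral_congr fun y hyy => ?_).trans
      intervalIntegral.integral_zero
    rw [uIcc_of_le hy] at hyy
    simp only [hf, hc, hw]
    rw [smoothTransition.zero_of_nonpos (by linarith [hr y hyy]), mul_zero]
  have hmem : ∀ y ∈ uIcc y₁ y₂, (x₀, y) ∈ U := fun y hyy => hsub ⟨left_mem_uIcc, hyy⟩
  have hf_left : ∫ y in y₁..y₂, f (x₀, y) = Ψ (x₀, y₂) - Ψ (x₀, y₁) - k * (y₂ - y₁) := by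
    have hcongr : ∫ y in y₁..y₂, f (x₀, y) = ∫ y in y₁..y₂, (pd2 Ψ (x₀, y) - k) := by
      refine intervalIntegral.integral_congr fun y hyy => ?_
      rw [uIcc_of_le hy] at hyy
      simp only [hf, hc, hw]
      rw [smoothTransition.one_of_one_le (by linarith [hl y hyy]), mul_one]
    have hii : IntervalIntegrable (fun y => pd2 Ψ (x₀, y)) MeasureTheory.volume y₁ y₂ :=
      ((h.contDiffOn_pd2 hU).continuousOn.comp (by fun_prop) hmem).intervalIntegrable
    rw [hcongr, intervalIntegral.integral_sub hii intervalIntegrable_const,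
      intervalIntegral.integral_const, smul_eq_mul, mul_comm k]
    congr 1
    refine intervalIntegral.integral_eq_sub_of_hasDerivAt (f := fun y => Ψ (x₀, y))
      (fun y hyy => ?_) hii
    exact (h.differentiableAt _ (hmem y hyy)).hasFDerivAt.comp_hasDerivAt y
      ((hasDerivAt_const y x₀).prodMk (hasDerivAt_id y))
  have h1 := abs_le.1 (hg_bound y₁ (left_mem_Icc.2 hy))
  have h2 := abs_le.1 (hg_bound y₂ (right_mem_Icc.2 hy))
  linarith [h1.1, h1.2, h2.1, h2.2]

lemma left_side_sub_ge (h : IsConjugateOn (Ioo 0 a ×ˢ Ioi 0) u Ψ)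
    (hcont : ContinuousOn Ψ (Icc 0 a ×ˢ Ici 0))
    (hleft : ∀ y₀ : ℝ, 0 < y₀ → Tendsto u (nhdsWithin (0, y₀) (Ioo 0 a ×ˢ Ioi 0)) atBot)
    {K δ y₁ y₂ : ℝ} (hK : 0 ≤ K) (hδ : δ ∈ Ioo 0 a) (hy₁ : 0 < y₁) (hy : y₁ ≤ y₂) :
    K / √(1 + K ^ 2) * (y₂ - y₁) - 2 * δ ≤ Ψ (0, y₂) - Ψ (0, y₁) := by
  have hU : IsOpen (Ioo (0 : ℝ) a ×ˢ Ioi (0 : ℝ)) := isOpen_Ioo.prod isOpen_Ioi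
  have hδc : ContinuousOn (fun y => u (δ, y) - K * δ) (Icc y₁ y₂) :=
    (h.contDiffOn.continuousOn.comp (by fun_prop)
      fun y hyy => ⟨hδ, hy₁.trans_le hyy.1⟩).sub continuousOn_const
  obtain ⟨b, hb⟩ := (isCompact_Icc.image_of_continuousOn hδc).bddBelow
  have hlow : ∀ᶠ x in 𝓝 (0 : ℝ), ∀ y ∈ Icc y₁ y₂,
      (x, y) ∈ Ioo (0 : ℝ) a ×ˢ Ioi (0 : ℝ) → u (x, y) ≤ b - 1 := by
    refine isCompact_Icc.eventually_forall_of_forall_eventually fun y hyy => ?_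
    exact eventually_nhdsWithin_iff.1
      ((hleft y (hy₁.trans_le hyy.1)).eventually (eventually_le_atBot (b - 1)))
  have htend : ∀ y, 0 < y → Tendsto (fun x : ℝ => Ψ (x, y)) (𝓝[>] 0) (𝓝 (Ψ (0, y))) := by
    intro y hy0
    have hx : Tendsto (fun x : ℝ => (x, y)) (𝓝[>] 0) (𝓝[Icc 0 a ×ˢ Ici 0] (0, y)) := by
      refine tendsto_nhdsWithin_iff.2 ⟨?_, ?_⟩
      · exact (Continuous.tendsto (by fun_prop : Continuous fun x : ℝ => (x, y)) 0).mono_left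
          nhdsWithin_le_nhds
      · filter_upwards [Ioo_mem_nhdsGT (hδ.1.trans hδ.2)] with x hxx
        exact ⟨Ioo_subset_Icc_self hxx, hy0.le⟩
    exact (hcont (0, y) ⟨left_mem_Icc.2 (hδ.1.trans hδ.2).le, hy0.le⟩).tendsto.comp hx
  refine ge_of_tendsto ((htend y₂ (hy₁.trans_le hy)).sub (htend y₁ hy₁)) ?_
  filter_upwards [nhdsWithin_le_nhds hlow, Ioo_mem_nhdsGT hδ.1] with x hxl hxx
  have hxa : x < a := hxx.2.trans hδ.2
  have hflux := h.flux_comparison hU (K := K) (b := b) hxx.2.le hy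
    (fun z hz => ⟨⟨hxx.1.trans_le hz.1.1, hz.1.2.trans_lt hδ.2⟩, hy₁.trans_le hz.2.1⟩)
    (fun y hyy => by
      have := hxl y hyy ⟨⟨hxx.1, hxa⟩, hy₁.trans_le hyy.1⟩
      have := mul_nonneg hK hxx.1.le
      linarith)
    (fun y hyy => hb (mem_image_of_mem _ hyy))
  linarith [hxx.1]

/-- `Ψ` grows at least at unit speed along a side on which `u = -∞`. -/
lemma left_side_growth (ha : 0 < a) (h : IsConjugateOn (Ioo 0 a ×ˢ Ioi 0) u Ψ)
    (hcont : ContinuousOn Ψ (Icc 0 a ×ˢ Ici 0))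
    (hleft : ∀ y₀ : ℝ, 0 < y₀ → Tendsto u (nhdsWithin (0, y₀) (Ioo 0 a ×ˢ Ioi 0)) atBot)
    {y₁ y₂ : ℝ} (hy₁ : 0 ≤ y₁) (hy : y₁ ≤ y₂) : y₂ - y₁ ≤ Ψ (0, y₂) - Ψ (0, y₁) := by
  have hpos : ∀ y, 0 < y → y ≤ y₂ → y₂ - y ≤ Ψ (0, y₂) - Ψ (0, y) := by
    intro y hy0 hyy
    have hK : ∀ K : ℝ, 0 ≤ K → K / √(1 + K ^ 2) * (y₂ - y) ≤ Ψ (0, y₂) - Ψ (0, y) := by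
      intro K hK
      have hlim : Tendsto (fun δ : ℝ => K / √(1 + K ^ 2) * (y₂ - y) - 2 * δ) (𝓝[>] 0)
          (𝓝 (K / √(1 + K ^ 2) * (y₂ - y) - 2 * 0)) :=
        (Continuous.tendsto (by fun_prop) 0).mono_left nhdsWithin_le_nhds
      rw [mul_zero, sub_zero] at hlim
      refine le_of_tendsto hlim ?_
      filter_upwards [Ioo_mem_nhdsGT ha] with δ hδ
      exact h.left_side_sub_ge hcont hleft hK hδ hy0 hyy
    have hlim : Tendsto (fun n : ℕ => (n : ℝ) / (n + 1) * (y₂ - y)) atTop (𝓝 (1 * (y₂ - y))) :=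
      (tendsto_natCast_div_add_atTop (1 : ℝ)).mul_const _
    rw [one_mul] at hlim
    refine le_of_tendsto hlim (Eventually.of_forall fun n => ?_)
    refine le_trans ?_ (hK n n.cast_nonneg)
    have hsqrt : √(1 + (n : ℝ) ^ 2) ≤ n + 1 :=
      Real.sqrt_le_iff.2 ⟨by positivity, by nlinarith [n.cast_nonneg (α := ℝ)]⟩
    have := sub_nonneg.2 hyy
    gcongr
  rcases hy.eq_or_lt with rfl | hlt
  · simp
  have hx : Tendsto (fun y : ℝ => ((0 : ℝ), y)) (𝓝[>] y₁) (𝓝[Icc 0 a ×ˢ Ici 0] (0, y₁)) := by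
    refine tendsto_nhdsWithin_iff.2 ⟨?_, ?_⟩
    · exact (Continuous.tendsto (by fun_prop : Continuous fun y : ℝ => ((0 : ℝ), y)) y₁).mono_left
        nhdsWithin_le_nhds
    · filter_upwards [self_mem_nhdsWithin] with y hyy
      exact ⟨left_mem_Icc.2 ha.le, hy₁.trans (mem_Ioi.1 hyy).le⟩
  have hΨ := (hcont (0, y₁) ⟨left_mem_Icc.2 ha.le, hy₁⟩).tendsto.comp hx
  have hid : Tendsto (fun y : ℝ => y₂ - y) (𝓝[>] y₁) (𝓝 (y₂ - y₁)) :=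
    (Continuous.tendsto (by fun_prop) y₁).mono_left nhdsWithin_le_nhds
  refine le_of_tendsto_of_tendsto hid (hΨ.const_sub _) ?_
  filter_upwards [Ioo_mem_nhdsGT hlt] with y hyy
  exact hpos y (hy₁.trans_lt hyy.1) hyy.2.le

lemma sub_le_dist_left_side (h : IsConjugateOn (Ioo 0 a ×ˢ Ioi 0) u Ψ)
    (hcont : ContinuousOn Ψ (Icc 0 a ×ˢ Ici 0)) {x y Y : ℝ} (hx : x ∈ Ioc 0 a) (hy : 0 ≤ y)
    (hY : 0 < Y) : Ψ (0, Y) - Ψ (x, y) ≤ √(x ^ 2 + (Y - y) ^ 2) := by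
  set γ : ℝ → ℝ × ℝ := fun t => (t * x, Y + t * (y - Y)) with hγ
  have hγc : Continuous γ := by fun_prop
  have hγd : ∀ t, HasDerivAt γ (x, y - Y) t := fun t => by
    simpa using ((hasDerivAt_id t).mul_const x).prodMk
      (((hasDerivAt_id t).mul_const (y - Y)).const_add Y)
  have hγS : ∀ t ∈ Ioo (0 : ℝ) 1, γ t ∈ Ioo 0 a ×ˢ Ioi 0 := fun t ht =>
    ⟨⟨mul_pos ht.1 hx.1, by nlinarith [ht.1, ht.2, hx.1, hx.2]⟩,
      show 0 < Y + t * (y - Y) by nlinarith [mul_nonneg ht.1.le hy, mul_pos (sub_pos.2 ht.2) hY]⟩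
  have hγC : MapsTo γ (Icc 0 1) (Icc 0 a ×ˢ Ici 0) := fun t ht =>
    ⟨⟨mul_nonneg ht.1 hx.1.le, by nlinarith [ht.1, ht.2, hx.1, hx.2]⟩,
      show 0 ≤ Y + t * (y - Y) by
        nlinarith [mul_nonneg ht.1 hy, mul_nonneg (sub_nonneg.2 ht.2) hY.le]⟩
  obtain ⟨t, ht, hslope⟩ := exists_hasDerivAt_eq_slope (Ψ ∘ γ)
    (fun t => fderiv ℝ Ψ (γ t) (x, y - Y)) one_pos (hcont.comp hγc.continuousOn hγC)
    fun t ht => (h.differentiableAt _ (hγS t ht)).hasFDerivAt.comp_hasDerivAt t (hγd t)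
  have hends : Ψ (0, Y) - Ψ (x, y) = -(x * pd1 Ψ (γ t) + (y - Y) * pd2 Ψ (γ t)) := by
    rw [fderiv_eq_pd] at hslope
    rw [hslope]
    simp [hγ]
  rw [hends]
  refine Real.le_sqrt_of_sq_le ?_
  nlinarith [mul_le_mul_of_nonneg_left (h.pd1_sq_add_pd2_sq_le (hγS t ht))
    (by positivity : 0 ≤ x ^ 2 + (Y - y) ^ 2),
    sq_nonneg (x * pd2 Ψ (γ t) - (y - Y) * pd1 Ψ (γ t))]

lemma left_side_le (ha : 0 < a) (h : IsConjugateOn (Ioo 0 a ×ˢ Ioi 0) u Ψ)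
    (hcont : ContinuousOn Ψ (Icc 0 a ×ˢ Ici 0))
    (hleft : ∀ y₀ : ℝ, 0 < y₀ → Tendsto u (nhdsWithin (0, y₀) (Ioo 0 a ×ˢ Ioi 0)) atBot)
    {x y : ℝ} (hx : x ∈ Ioc 0 a) (hy : 0 ≤ y) : Ψ (0, y) ≤ Ψ (x, y) := by
  refine le_of_forall_pos_le_add fun ε hε => ?_
  set T := x ^ 2 / ε with hT
  have hTpos : 0 < T := div_pos (pow_pos hx.1 2) hε
  have hlip := h.sub_le_dist_left_side hcont hx hy (Y := y + T) (by linarith)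
  have hgrow := h.left_side_growth ha hcont hleft hy (y₂ := y + T) (by linarith)
  have hsqrt : √(x ^ 2 + (y + T - y) ^ 2) ≤ T + ε := by
    have hTε : T * ε = x ^ 2 := div_mul_cancel₀ _ hε.ne'
    exact Real.sqrt_le_iff.2 ⟨by positivity, by nlinarith [sq_nonneg ε, mul_pos hTpos hε]⟩
  linarith

/-- Reflecting the strip and changing the sign of `u` exchanges the two sides. -/
lemma reflect (h : IsConjugateOn (Ioo 0 a ×ˢ Ioi 0) u Ψ) :
    IsConjugateOn (Ioo 0 a ×ˢ Ioi 0) (fun z => -u (a - z.1, z.2))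
      (fun z => Ψ (a - z.1, z.2)) := by
  have hU : IsOpen (Ioo (0 : ℝ) a ×ˢ Ioi (0 : ℝ)) := isOpen_Ioo.prod isOpen_Ioi
  have hmaps : ∀ z ∈ Ioo (0 : ℝ) a ×ˢ Ioi (0 : ℝ), (a - z.1, z.2) ∈ Ioo (0 : ℝ) a ×ˢ Ioi (0 : ℝ) :=
    fun z hz => ⟨⟨by linarith [hz.1.2], by linarith [hz.1.1]⟩, hz.2⟩
  have hud : ∀ z ∈ Ioo (0 : ℝ) a ×ˢ Ioi (0 : ℝ), DifferentiableAt ℝ u z := fun z hz =>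
    (h.contDiffOn.contDiffAt (hU.mem_nhds hz)).differentiableAt two_ne_zero
  have hr : ∀ z : ℝ × ℝ, HasFDerivAt (fun z : ℝ × ℝ => (a - z.1, z.2))
      ((-ContinuousLinearMap.fst ℝ ℝ ℝ).prod (ContinuousLinearMap.snd ℝ ℝ ℝ)) z := fun z =>
    (hasFDerivAt_fst.const_sub a).prodMk hasFDerivAt_snd
  have hΨr : ∀ z ∈ Ioo (0 : ℝ) a ×ˢ Ioi (0 : ℝ),
      HasFDerivAt (fun z : ℝ × ℝ => Ψ (a - z.1, z.2)) _ z :=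
    fun z hz => (h.differentiableAt _ (hmaps z hz)).hasFDerivAt.comp z (hr z)
  have hur : ∀ z ∈ Ioo (0 : ℝ) a ×ˢ Ioi (0 : ℝ),
      HasFDerivAt (fun z : ℝ × ℝ => -u (a - z.1, z.2)) _ z :=
    fun z hz => ((hud _ (hmaps z hz)).hasFDerivAt.comp z (hr z)).neg
  have hp : ∀ z ∈ Ioo (0 : ℝ) a ×ˢ Ioi (0 : ℝ),
      pd1 (fun z => -u (a - z.1, z.2)) z = pd1 u (a - z.1, z.2) := fun z hz => by
    rw [pd1, (hur z hz).fderiv]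
    simp [fderiv_eq_pd]
  have hq : ∀ z ∈ Ioo (0 : ℝ) a ×ˢ Ioi (0 : ℝ),
      pd2 (fun z => -u (a - z.1, z.2)) z = -pd2 u (a - z.1, z.2) := fun z hz => by
    rw [pd2, (hur z hz).fderiv]
    simp [fderiv_eq_pd]
  have hW : ∀ z ∈ Ioo (0 : ℝ) a ×ˢ Ioi (0 : ℝ),
      Wf (fun z => -u (a - z.1, z.2)) z = Wf u (a - z.1, z.2) := fun z hz => by
    rw [Wf, hp z hz, hq z hz, Wf, neg_sq]
  refine ⟨(h.contDiffOn.comp (ContDiff.contDiffOn (by fun_prop)) hmaps).neg,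
    fun z hz => (hΨr z hz).differentiableAt, fun z hz => ?_, fun z hz => ?_⟩
  · rw [hq z hz, hW z hz, neg_neg, pd1, (hΨr z hz).fderiv]
    simp [fderiv_eq_pd, h.pd1_eq _ (hmaps z hz), neg_div]
  · rw [hp z hz, hW z hz, pd2, (hΨr z hz).fderiv]
    simp [fderiv_eq_pd, h.pd2_eq _ (hmaps z hz)]

end IsConjugateOn

/-- **Equality of the conjugate function on the two sides of a half-strip and its
nonnegativity** (Corollary `P=Q` of the paper): if `u` solves the MSE on
`(0,a) × (0,∞)` with boundary value `−∞` on the left side and `+∞` on the right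
side, and `Ψ` is a conjugate function of `u` extended continuously to the closed
half-strip, then `Ψ(0,y) = Ψ(a,y)` for all `y ≥ 0`, and if `Ψ(0,0) = 0` then
`Ψ ≥ 0` on the closed half-strip. -/
theorem stmt_2 (a : ℝ) (ha : 0 < a) (u Ψ : ℝ × ℝ → ℝ)
    (S : Set (ℝ × ℝ)) (hS : S = Set.Ioo (0 : ℝ) a ×ˢ Set.Ioi (0 : ℝ))
    (hu : IsMSESolution S u)
    (hleft : ∀ y₀ : ℝ, 0 < y₀ → Tendsto u (nhdsWithin ((0 : ℝ), y₀) S) atBot)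
    (hright : ∀ y₀ : ℝ, 0 < y₀ → Tendsto u (nhdsWithin ((a : ℝ), y₀) S) atTop)
    (hΨcont : ContinuousOn Ψ (Set.Icc (0 : ℝ) a ×ˢ Set.Ici (0 : ℝ)))
    (hΨdiff : ∀ z ∈ S, DifferentiableAt ℝ Ψ z)
    (hΨx : ∀ z ∈ S, pd1 Ψ z = - pd2 u z / Wf u z)
    (hΨy : ∀ z ∈ S, pd2 Ψ z = pd1 u z / Wf u z) :
    (∀ y : ℝ, 0 ≤ y → Ψ ((0 : ℝ), y) = Ψ ((a : ℝ), y)) ∧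
      (Ψ ((0 : ℝ), (0 : ℝ)) = 0 →
        ∀ z ∈ Set.Icc (0 : ℝ) a ×ˢ Set.Ici (0 : ℝ), 0 ≤ Ψ z) := by
  subst hS
  have h : IsConjugateOn (Ioo 0 a ×ˢ Ioi 0) u Ψ := ⟨hu.1, hΨdiff, hΨx, hΨy⟩
  have hmaps : MapsTo (fun z : ℝ × ℝ => (a - z.1, z.2)) (Icc 0 a ×ˢ Ici 0) (Icc 0 a ×ˢ Ici 0) :=
    fun z hz => ⟨⟨by linarith [hz.1.2], by linarith [hz.1.1]⟩, hz.2⟩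
  have hleft' : ∀ y₀ : ℝ, 0 < y₀ → Tendsto (fun z : ℝ × ℝ => -u (a - z.1, z.2))
      (nhdsWithin (0, y₀) (Ioo 0 a ×ˢ Ioi 0)) atBot := by
    intro y₀ hy₀
    refine tendsto_neg_atTop_atBot.comp ((hright y₀ hy₀).comp (tendsto_nhdsWithin_iff.2 ⟨?_, ?_⟩))
    · have hc : Continuous fun z : ℝ × ℝ => (a - z.1, z.2) := by fun_prop
      simpa using (hc.tendsto (0, y₀)).mono_left nhdsWithin_le_nhds
    · filter_upwards [self_mem_nhdsWithin] with z hz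
      exact ⟨⟨by linarith [hz.1.2], by linarith [hz.1.1]⟩, hz.2⟩
  have hle : ∀ x ∈ Ioc 0 a, ∀ y, 0 ≤ y → Ψ (0, y) ≤ Ψ (x, y) :=
    fun x hx y hy => h.left_side_le ha hΨcont hleft hx hy
  refine ⟨fun y hy => le_antisymm (hle a ⟨ha, le_rfl⟩ y hy) ?_, fun h0 z hz => ?_⟩
  · simpa using h.reflect.left_side_le ha (hΨcont.comp (by fun_prop) hmaps) hleft' ⟨ha, le_rfl⟩ hy
  · obtain ⟨x, y⟩ := z
    have hside : 0 ≤ Ψ (0, y) := by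
      have := h.left_side_growth ha hΨcont hleft le_rfl hz.2
      simp only [h0, sub_zero] at this
      exact le_trans hz.2 this
    rcases hz.1.1.eq_or_lt with hx | hx
    · simp only at hx
      rwa [← hx]
    · exact hside.trans (hle x ⟨hx, hz.1.2⟩ y hz.2)
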